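/- Let (u,v) ∈ H¹(ℝ³)×H¹(ℝ³) be a weak solution of the system −Δu + u + λφ_{u,v}u = |u|^{2q−2}u + β|v|^q|u|^{q−2}u, −Δv + v + λφ_{u,v}v = |v|^{2q−2}v + β|u|^q|v|^{q−2}v, with u,v ∈ L^{2q}(ℝ³), satisfying the Nehari identities and the Pohozaev identity. If q ≥ 3, then (u,v) = (0,0). -/

import Mathlib

open MeasureTheory

theorem stmt_17 (q lam β : ℝ) (hq : 3 ≤ q) (hlam : 0 < lam) (hβ : 0 ≤ β)
    (u v φ : EuclideanSpace ℝ (Fin 3) → ℝ)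
    (hφ : ∀ x, φ x = ∫ y, (u y ^ 2 + v y ^ 2) / dist x y)
    (hu2 : Integrable (fun x => u x ^ 2)) (hv2 : Integrable (fun x => v x ^ 2))
    (hgu : Integrable (fun x => ‖fderiv ℝ u x‖ ^ 2))
    (hgv : Integrable (fun x => ‖fderiv ℝ v x‖ ^ 2))
    (hφu : Integrable (fun x => u x ^ 2 * φ x))
    (hφv : Integrable (fun x => v x ^ 2 * φ x))
    (hLu : Integrable (fun x => |u x| ^ (2 * q)))
    (hLv : Integrable (fun x => |v x| ^ (2 * q)))
    (hLuv : Integrable (fun x => |u x| ^ q * |v x| ^ q))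
    (hNu : (∫ x, ‖fderiv ℝ u x‖ ^ 2) + (∫ x, u x ^ 2) + lam * (∫ x, u x ^ 2 * φ x)
      = (∫ x, |u x| ^ (2 * q)) + β * (∫ x, |u x| ^ q * |v x| ^ q))
    (hNv : (∫ x, ‖fderiv ℝ v x‖ ^ 2) + (∫ x, v x ^ 2) + lam * (∫ x, v x ^ 2 * φ x)
      = (∫ x, |v x| ^ (2 * q)) + β * (∫ x, |u x| ^ q * |v x| ^ q))
    (hPoh : (1/2) * ((∫ x, ‖fderiv ℝ u x‖ ^ 2) + (∫ x, ‖fderiv ℝ v x‖ ^ 2))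
        + (3/2) * ((∫ x, u x ^ 2) + (∫ x, v x ^ 2))
        + (5/4) * lam * ((∫ x, u x ^ 2 * φ x) + (∫ x, v x ^ 2 * φ x))
      = (3/(2*q)) * ((∫ x, |u x| ^ (2 * q)) + (∫ x, |v x| ^ (2 * q))
          + 2 * β * (∫ x, |u x| ^ q * |v x| ^ q))) :
    u =ᵐ[volume] 0 ∧ v =ᵐ[volume] 0 := by
  have hφ0 : ∀ x, 0 ≤ φ x := fun x => by
    rw [hφ x]
    exact integral_nonneg fun y => by positivity
  have hA : 0 ≤ ∫ x, ‖fderiv ℝ u x‖ ^ 2 := integral_nonneg fun x => by positivity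
  have hB : 0 ≤ ∫ x, ‖fderiv ℝ v x‖ ^ 2 := integral_nonneg fun x => by positivity
  have hM : 0 ≤ ∫ x, u x ^ 2 := integral_nonneg fun x => by positivity
  have hN : 0 ≤ ∫ x, v x ^ 2 := integral_nonneg fun x => by positivity
  have hD : 0 ≤ ∫ x, u x ^ 2 * φ x :=
    integral_nonneg fun x => mul_nonneg (sq_nonneg _) (hφ0 x)
  have hE : 0 ≤ ∫ x, v x ^ 2 * φ x :=
    integral_nonneg fun x => mul_nonneg (sq_nonneg _) (hφ0 x)
  have key : (∫ x, u x ^ 2) = 0 ∧ (∫ x, v x ^ 2) = 0 := by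
    clear hφ hu2 hv2 hgu hgv hφu hφv hLu hLv hLuv
    generalize (∫ x, ‖fderiv ℝ u x‖ ^ 2) = A at *
    generalize (∫ x, ‖fderiv ℝ v x‖ ^ 2) = B at *
    generalize (∫ x, u x ^ 2) = M at *
    generalize (∫ x, v x ^ 2) = N at *
    generalize (∫ x, u x ^ 2 * φ x) = D at *
    generalize (∫ x, v x ^ 2 * φ x) = E at *
    generalize (∫ x, |u x| ^ (2 * q)) = P at *
    generalize (∫ x, |v x| ^ (2 * q)) = Q at *
    generalize (∫ x, |u x| ^ q * |v x| ^ q) = R at *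
    have hq0 : q ≠ 0 := by linarith
    have h2 : (q / 3) * (A + B) + q * (M + N) + (5 * q / 6) * (lam * (D + E))
        = P + Q + 2 * β * R := by
      have h3 : P + Q + 2 * β * R
          = (2 * q / 3) * ((3 / (2 * q)) * (P + Q + 2 * β * R)) := by
        field_simp
      rw [h3, ← hPoh]
      ring
    have hid : (q / 3 - 1) * (A + B) + (q - 1) * (M + N)
        + (5 * q / 6 - 1) * (lam * (D + E)) = 0 := by linarith
    have t1 : 0 ≤ (q / 3 - 1) * (A + B) :=
      mul_nonneg (by linarith) (by linarith)
    have t3 : 0 ≤ (5 * q / 6 - 1) * (lam * (D + E)) :=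
      mul_nonneg (by linarith) (mul_nonneg hlam.le (by linarith))
    have t2 : 2 * (M + N) ≤ (q - 1) * (M + N) :=
      mul_le_mul_of_nonneg_right (by linarith) (by linarith)
    constructor <;> linarith
  constructor
  · have h := (integral_eq_zero_iff_of_nonneg (fun x => sq_nonneg (u x)) hu2).1 key.1
    filter_upwards [h] with x hx
    simpa using hx
  · have h := (integral_eq_zero_iff_of_nonneg (fun x => sq_nonneg (v x)) hv2).1 key.2
    filter_upwards [h] with x hx
    simpa using hx
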